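/- Two-dimensional compression does not decrease mutual information: for any Boolean function b: \{0,1\}^n \to \{0,1\} and any \mathcal{I} \subseteq \{1,\dots,n\} with |\mathcal{I}| = 2, the function \hat{b} defined by \hat{b}^{-1}(0) = C_{\mathcal{I}}(b^{-1}(0)) satisfies I(\hat{b}(X^n); Y^n) \ge I(b(X^n); Y^n). -/

import Mathlib

open Finset

/-- `f2 x = -x log₂ x`, the summand of base-2 Shannon entropy. -/
noncomputable def f2 (x : ℝ) : ℝ := -x * Real.logb 2 x

/-- Binary entropy function `H(α)` (base 2). -/
noncomputable def binEnt (α : ℝ) : ℝ := f2 α + f2 (1 - α)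

/-- Joint pmf of `(Xⁿ, Yⁿ)` where `Xⁿ` is i.i.d. Bernoulli(1/2) and
`Yⁿ = Xⁿ ⊕ Zⁿ` with `Zⁿ` i.i.d. Bernoulli(α) (a memoryless BSC(α)). -/
noncomputable def jointP (n : ℕ) (α : ℝ) (x y : Fin n → Bool) : ℝ :=
  (1/2)^n * ∏ i, (if x i = y i then 1 - α else α)

/-- `Pr{b(Xⁿ) = u, Yⁿ = y}`. -/
noncomputable def pBY (n : ℕ) (α : ℝ) (b : (Fin n → Bool) → Bool) (u : Bool)
    (y : Fin n → Bool) : ℝ :=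
  ∑ x : Fin n → Bool, if b x = u then jointP n α x y else 0

/-- `Pr{b(Xⁿ) = u}` for `Xⁿ` uniform on `{0,1}ⁿ`. -/
noncomputable def pB (n : ℕ) (b : (Fin n → Bool) → Bool) (u : Bool) : ℝ :=
  ∑ x : Fin n → Bool, if b x = u then (1/2)^n else 0

/-- `H(b(Xⁿ))`, the entropy of the Boolean function's output. -/
noncomputable def HB (n : ℕ) (b : (Fin n → Bool) → Bool) : ℝ :=
  ∑ u : Bool, f2 (pB n b u)

/-- `Pr{b(Xⁿ) = 0 ∣ Yⁿ = y}` (note `Pr{Yⁿ = y} = 2⁻ⁿ` since `Yⁿ` is uniform;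
`0` is encoded as `false`). -/
noncomputable def condP (n : ℕ) (α : ℝ) (b : (Fin n → Bool) → Bool)
    (y : Fin n → Bool) : ℝ :=
  (2:ℝ)^n * pBY n α b false y

/-- The conditional entropy `H(b(Xⁿ) ∣ Yⁿ)`. -/
noncomputable def condHB (n : ℕ) (α : ℝ) (b : (Fin n → Bool) → Bool) : ℝ :=
  ∑ y : Fin n → Bool, (1/2)^n * ∑ u : Bool, f2 ((2:ℝ)^n * pBY n α b u y)

/-- The mutual information `I(b(Xⁿ); Yⁿ) = H(b(Xⁿ)) - H(b(Xⁿ) ∣ Yⁿ)`. -/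
noncomputable def MI (n : ℕ) (α : ℝ) (b : (Fin n → Bool) → Bool) : ℝ :=
  HB n b - condHB n α b

/-- Fill the coordinates in `I` of `x` with the pattern `z`. -/
def merge {n : ℕ} (I : Finset (Fin n)) (x : Fin n → Bool)
    (z : {i // i ∈ I} → Bool) : Fin n → Bool :=
  fun i => if h : i ∈ I then z ⟨i, h⟩ else x i

/-- The `I`-section of `B` at `x`: the set of patterns on the coordinates of `I`
which complete the off-`I` part of `x` to an element of `B`. -/
def Isection {n : ℕ} (B : Finset (Fin n → Bool)) (I : Finset (Fin n))
    (x : Fin n → Bool) : Finset ({i // i ∈ I} → Bool) :=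
  Finset.univ.filter (fun z => merge I x z ∈ B)

/-- Numeric value of a pattern on the coordinates of `I`, with smaller indices more
significant: a pattern precedes another in the lexicographic order iff its value is
smaller, so the initial segment `L_{|I|}(M)` is exactly `{z ∣ secVal I z < M}`. -/
def secVal {n : ℕ} (I : Finset (Fin n)) (z : {i // i ∈ I} → Bool) : ℕ :=
  ∑ i : {i // i ∈ I}, if z i then 2 ^ (I.filter (fun j => i.val < j)).card else 0

/-- The `I`-compression `C_I(B)`: each `I`-section of `B` is replaced by the initial
segment of the same cardinality in the lexicographic order on patterns. -/
def compress {n : ℕ} (I : Finset (Fin n)) (B : Finset (Fin n → Bool)) :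
    Finset (Fin n → Bool) :=
  Finset.univ.filter (fun y => secVal I (fun i => y i.val) < (Isection B I y).card)

namespace TDC

lemma gibbs (a p : ℝ) (ha : 0 ≤ a) (hp : 0 < p) :
    Real.negMulLog a ≤ -a * Real.log p + (p - a) := by
  rcases ha.eq_or_lt with rfl | ha
  · simp [hp.le]
  · have h1 := Real.log_le_sub_one_of_pos (div_pos hp ha)
    rw [Real.log_div hp.ne' ha.ne'] at h1
    have h2 := mul_le_mul_of_nonneg_left h1 ha.le
    have h3 : a * (p / a - 1) = p - a := by field_simp
    rw [h3] at h2
    unfold Real.negMulLog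
    linarith

lemma super (a p : ℝ) (ha : 0 ≤ a) (ha1 : a ≤ 1) (hp : 0 < p) (hp1 : p < 1) :
    Real.binEntropy a ≤ Real.binEntropy p + (Real.log (1 - p) - Real.log p) * (a - p) := by
  rw [Real.binEntropy_eq_negMulLog_add_negMulLog_one_sub,
    Real.binEntropy_eq_negMulLog_add_negMulLog_one_sub]
  have h1 := gibbs a p ha hp
  have h2 := gibbs (1 - a) (1 - p) (by linarith) (by linarith)
  have h3 : Real.negMulLog p = -p * Real.log p := rfl
  have h4 : Real.negMulLog (1 - p) = -(1 - p) * Real.log (1 - p) := rfl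
  rw [h3, h4]
  linarith

lemma slope_anti (p q : ℝ) (hp : 0 < p) (hpq : p ≤ q) (hq : q < 1) :
    (Real.log (1 - q) - Real.log q) ≤ (Real.log (1 - p) - Real.log p) := by
  have h1 := Real.log_le_log hp hpq
  have h2 := Real.log_le_log (show 0 < 1 - q by linarith) (show 1 - q ≤ 1 - p by linarith)
  linarith

/-- Karamata, interior, sorted increasingly. -/
lemma kara_int (a p : Fin 4 → ℝ) (ha : ∀ i, 0 ≤ a i ∧ a i ≤ 1) (hp : ∀ i, 0 < p i ∧ p i < 1)
    (hmono : Monotone p)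
    (h1 : p 3 ≤ a 0) (h2 : p 3 + p 2 ≤ a 0 + a 1) (h3 : p 3 + p 2 + p 1 ≤ a 0 + a 1 + a 2)
    (h4 : p 0 + p 1 + p 2 + p 3 = a 0 + a 1 + a 2 + a 3) :
    ∑ i, Real.binEntropy (a i) ≤ ∑ i, Real.binEntropy (p i) := by
  rw [Fin.sum_univ_four, Fin.sum_univ_four]
  have e0 := super (a 0) (p 3) (ha 0).1 (ha 0).2 (hp 3).1 (hp 3).2
  have e1 := super (a 1) (p 2) (ha 1).1 (ha 1).2 (hp 2).1 (hp 2).2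
  have e2 := super (a 2) (p 1) (ha 2).1 (ha 2).2 (hp 1).1 (hp 1).2
  have e3 := super (a 3) (p 0) (ha 3).1 (ha 3).2 (hp 0).1 (hp 0).2
  have s1 := slope_anti (p 0) (p 1) (hp 0).1 (hmono (by decide)) (hp 1).2
  have s2 := slope_anti (p 1) (p 2) (hp 1).1 (hmono (by decide)) (hp 2).2
  have s3 := slope_anti (p 2) (p 3) (hp 2).1 (hmono (by decide)) (hp 3).2
  generalize (Real.log (1 - p 0) - Real.log (p 0)) = c0 at *
  generalize (Real.log (1 - p 1) - Real.log (p 1)) = c1 at *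
  generalize (Real.log (1 - p 2) - Real.log (p 2)) = c2 at *
  generalize (Real.log (1 - p 3) - Real.log (p 3)) = c3 at *
  have m1 := mul_nonneg (sub_nonneg.2 s3) (sub_nonneg.2 h1)
  have m2 := mul_nonneg (sub_nonneg.2 s2) (sub_nonneg.2 h2)
  have m3 := mul_nonneg (sub_nonneg.2 s1) (sub_nonneg.2 h3)
  have m4 : c0 * (a 0 + a 1 + a 2 + a 3 - (p 0 + p 1 + p 2 + p 3)) = 0 := by rw [h4]; ring
  linarith

lemma kara_sorted (a p : Fin 4 → ℝ) (ha : ∀ i, 0 ≤ a i ∧ a i ≤ 1) (hp : ∀ i, 0 ≤ p i ∧ p i ≤ 1)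
    (hmono : Monotone p)
    (h1 : p 3 ≤ a 0) (h2 : p 3 + p 2 ≤ a 0 + a 1) (h3 : p 3 + p 2 + p 1 ≤ a 0 + a 1 + a 2)
    (h4 : p 0 + p 1 + p 2 + p 3 = a 0 + a 1 + a 2 + a 3) :
    ∑ i, Real.binEntropy (a i) ≤ ∑ i, Real.binEntropy (p i) := by
  have key : ∀ e ∈ Set.Ioo (0:ℝ) 1, ∑ i, Real.binEntropy ((1 - e) * a i + e / 2) ≤
      ∑ i, Real.binEntropy ((1 - e) * p i + e / 2) := by
    intro e he
    have he0 := he.1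
    have he1 : 0 < 1 - e := by linarith [he.2]
    have hb : ∀ q : ℝ, 0 ≤ q ∧ q ≤ 1 → 0 < (1 - e) * q + e / 2 ∧ (1 - e) * q + e / 2 < 1 := by
      intro q hq
      have := mul_nonneg he1.le hq.1
      have := mul_nonneg he1.le (sub_nonneg.2 hq.2)
      constructor <;> nlinarith
    apply kara_int
    · exact fun i => ⟨(hb _ (ha i)).1.le, (hb _ (ha i)).2.le⟩
    · exact fun i => hb _ (hp i)
    · intro i j hij
      have := mul_le_mul_of_nonneg_left (hmono hij) he1.le
      dsimp only
      linarith
    · have := mul_le_mul_of_nonneg_left h1 he1.le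
      linarith
    · have := mul_le_mul_of_nonneg_left h2 he1.le
      linarith
    · have := mul_le_mul_of_nonneg_left h3 he1.le
      linarith
    · have := congrArg (fun t => (1 - e) * t) h4
      linarith
  have hc : ∀ q : Fin 4 → ℝ, Filter.Tendsto
      (fun e : ℝ => ∑ i, Real.binEntropy ((1 - e) * q i + e / 2)) (nhdsWithin 0 (Set.Ioi 0))
      (nhds (∑ i, Real.binEntropy (q i))) := by
    intro q
    have : Continuous (fun e : ℝ => ∑ i, Real.binEntropy ((1 - e) * q i + e / 2)) := by
      have := Real.binEntropy_continuous
      fun_prop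
    have h := this.tendsto 0
    simp only [sub_zero, one_mul, zero_div, add_zero] at h
    exact h.mono_left nhdsWithin_le_nhds
  refine le_of_tendsto_of_tendsto (hc a) (hc p) ?_
  filter_upwards [Ioo_mem_nhdsGT (show (0:ℝ) < 1 by norm_num)] with e he
  exact key e he

lemma kara (a p : Fin 4 → ℝ) (ha : ∀ i, 0 ≤ a i ∧ a i ≤ 1) (hp : ∀ i, 0 ≤ p i ∧ p i ≤ 1)
    (h1 : ∀ i, p i ≤ a 0) (h2 : ∀ i j, i ≠ j → p i + p j ≤ a 0 + a 1) (h3 : ∀ i, a 3 ≤ p i)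
    (h4 : ∑ i, p i = ∑ i, a i) :
    ∑ i, Real.binEntropy (a i) ≤ ∑ i, Real.binEntropy (p i) := by
  let σ := Tuple.sort p
  have hm : Monotone (p ∘ σ) := Tuple.monotone_sort p
  have hs : ∑ i, (p ∘ σ) i = ∑ i, p i := Equiv.sum_comp σ p
  have hs2 : ∑ i, Real.binEntropy ((p ∘ σ) i) = ∑ i, Real.binEntropy (p i) :=
    Equiv.sum_comp σ (fun i => Real.binEntropy (p i))
  rw [← hs2]
  rw [← hs, Fin.sum_univ_four, Fin.sum_univ_four] at h4
  have h30 := h3 (σ 0)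
  refine kara_sorted a (p ∘ σ) ha (fun i => hp _) hm (h1 _) (h2 _ _ ?_) ?_ h4
  · intro h
    exact absurd (σ.injective h) (by decide)
  · simp only [Function.comp] at *
    linarith

/-- Update both coordinates. -/
def upd {n : ℕ} (i j : Fin n) (s t : Bool) (x : Fin n → Bool) : Fin n → Bool :=
  Function.update (Function.update x i s) j t

lemma avg1 {n : ℕ} (i : Fin n) (F : (Fin n → Bool) → ℝ) :
    ∑ x, (F (Function.update x i false) + F (Function.update x i true)) = 2 * ∑ x, F x := by
  have hinv : Function.Involutive (fun x : Fin n → Bool => Function.update x i (!x i)) := by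
    intro x; simp
  have h : ∑ x, F (Function.update x i (!x i)) = ∑ x, F x := Equiv.sum_comp hinv.toPerm F
  have h2 : ∀ x : Fin n → Bool, F (Function.update x i false) + F (Function.update x i true) =
      F x + F (Function.update x i (!x i)) := by
    intro x
    have hx : Function.update x i (x i) = x := Function.update_eq_self i x
    cases hxi : x i <;> rw [hxi] at hx
    · rw [hx]; rfl
    · rw [hx, add_comm]; rfl
  simp_rw [h2, Finset.sum_add_distrib, h]
  ring

lemma avg2 {n : ℕ} (i j : Fin n) (F : (Fin n → Bool) → ℝ) :
    ∑ x, F x = (1 / 4) * ∑ x, (F (upd i j false false x) + F (upd i j false true x) +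
      F (upd i j true false x) + F (upd i j true true x)) := by
  have h := avg1 i (fun x => F (Function.update x j false) + F (Function.update x j true))
  rw [avg1 j F] at h
  have : ∑ x, F x = (1 / 4) * (2 * (2 * ∑ x, F x)) := by ring
  rw [this, ← h]
  congr 1
  apply Finset.sum_congr rfl
  intro x _
  simp only [upd]
  ring

noncomputable def ind (β : Bool) : ℝ := if β = false then 1 else 0

noncomputable def K (α : ℝ) (s t : Bool) : ℝ := if s = t then 1 - α else α

noncomputable def W (n : ℕ) (α : ℝ) (x y : Fin n → Bool) : ℝ := ∏ i, K α (x i) (y i)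

noncomputable def P (n : ℕ) (α : ℝ) (b : (Fin n → Bool) → Bool) (y : Fin n → Bool) : ℝ :=
  ∑ x, ind (b x) * W n α x y

noncomputable def R {n : ℕ} (α : ℝ) (i j : Fin n) (x y : Fin n → Bool) : ℝ :=
  ∏ l ∈ (univ.erase i).erase j, K α (x l) (y l)

/-- local smoothed indicator -/
noncomputable def Q (α : ℝ) (β : Bool → Bool → Bool) (s t : Bool) : ℝ :=
  ind (β false false) * (K α false s * K α false t) + ind (β false true) * (K α false s * K α true t)
  + ind (β true false) * (K α true s * K α false t) + ind (β true true) * (K α true s * K α true t)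

lemma W_upd {n : ℕ} (α : ℝ) {i j : Fin n} (hij : i ≠ j) (s t s' t' : Bool) (x y : Fin n → Bool) :
    W n α (upd i j s' t' x) (upd i j s t y) = R α i j x y * (K α s' s * K α t' t) := by
  unfold W R
  rw [← Finset.mul_prod_erase univ _ (mem_univ i),
    ← Finset.mul_prod_erase (univ.erase i) _ (show j ∈ univ.erase i by simp [hij.symm])]
  have : ∀ l ∈ (univ.erase i).erase j, K α (upd i j s' t' x l) (upd i j s t y l)
      = K α (x l) (y l) := by
    intro l hl
    simp only [mem_erase, mem_univ, and_true] at hl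
    simp [upd, hl.1, hl.2]
  rw [Finset.prod_congr rfl this]
  simp [upd, hij]
  ring

lemma P_upd {n : ℕ} (α : ℝ) {i j : Fin n} (hij : i ≠ j) (b : (Fin n → Bool) → Bool) (s t : Bool)
    (y : Fin n → Bool) :
    P n α b (upd i j s t y) =
      ∑ x, (1 / 4 * R α i j x y) * Q α (fun s t => b (upd i j s t x)) s t := by
  unfold P
  rw [avg2 i j, Finset.mul_sum]
  apply Finset.sum_congr rfl
  intro x _
  simp only [W_upd α hij, Q]
  ring

lemma K_nonneg {α : ℝ} (hα : α ∈ Set.Icc (0:ℝ) (1/2)) (s t : Bool) : 0 ≤ K α s t := by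
  unfold K
  split_ifs <;> linarith [hα.1, hα.2]

lemma W_sum (n : ℕ) (α : ℝ) (y : Fin n → Bool) : ∑ x, W n α x y = 1 := by
  unfold W
  have := Finset.prod_univ_sum (fun _ : Fin n => (univ : Finset Bool)) (fun i s => K α s (y i))
  rw [Fintype.piFinset_univ] at this
  rw [← this]
  apply Finset.prod_eq_one
  intro i _
  cases y i <;> simp [K]

lemma W_nonneg {n : ℕ} {α : ℝ} (hα : α ∈ Set.Icc (0:ℝ) (1/2)) (x y : Fin n → Bool) :
    0 ≤ W n α x y := Finset.prod_nonneg fun _ _ => K_nonneg hα _ _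

lemma P_mem {n : ℕ} {α : ℝ} (hα : α ∈ Set.Icc (0:ℝ) (1/2)) (b : (Fin n → Bool) → Bool)
    (y : Fin n → Bool) : 0 ≤ P n α b y ∧ P n α b y ≤ 1 := by
  constructor
  · apply Finset.sum_nonneg
    intro x _
    apply mul_nonneg _ (W_nonneg hα _ _)
    unfold ind; split_ifs <;> norm_num
  · rw [← W_sum n α y]
    apply Finset.sum_le_sum
    intro x _
    have := W_nonneg hα x y
    unfold ind; split_ifs <;> linarith

lemma pBY_false (n : ℕ) (α : ℝ) (b : (Fin n → Bool) → Bool) (y : Fin n → Bool) :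
    (2:ℝ)^n * pBY n α b false y = P n α b y := by
  unfold pBY P
  rw [Finset.mul_sum]
  apply Finset.sum_congr rfl
  intro x _
  have h2 : (2:ℝ)^n * (1/2)^n = 1 := by rw [← mul_pow]; norm_num
  have : (2:ℝ)^n * jointP n α x y = W n α x y := by
    unfold jointP W K
    rw [← mul_assoc, h2, one_mul]
  unfold ind
  split_ifs <;> simp [this]

lemma pBY_true (n : ℕ) (α : ℝ) (b : (Fin n → Bool) → Bool) (y : Fin n → Bool) :
    (2:ℝ)^n * pBY n α b true y = 1 - P n α b y := by
  unfold pBY P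
  rw [Finset.mul_sum, ← W_sum n α y, ← Finset.sum_sub_distrib]
  apply Finset.sum_congr rfl
  intro x _
  have h2 : (2:ℝ)^n * (1/2)^n = 1 := by rw [← mul_pow]; norm_num
  have : (2:ℝ)^n * jointP n α x y = W n α x y := by
    unfold jointP W K
    rw [← mul_assoc, h2, one_mul]
  unfold ind
  cases b x <;> simp [this]

lemma condHB_eq (n : ℕ) (α : ℝ) (b : (Fin n → Bool) → Bool) :
    condHB n α b = ((1/2)^n / Real.log 2) * ∑ y, Real.binEntropy (P n α b y) := by
  unfold condHB
  rw [Finset.mul_sum]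
  apply Finset.sum_congr rfl
  intro y _
  rw [Fintype.sum_bool, pBY_true, pBY_false,
    Real.binEntropy_eq_negMulLog_add_negMulLog_one_sub]
  unfold f2 Real.negMulLog Real.logb
  ring

/-- compressed local pattern -/
def hat (β : Bool → Bool → Bool) (s t : Bool) : Bool :=
  !decide ((if s then 2 else 0) + (if t then 1 else 0) <
    ((if β false false = false then 1 else 0) + (if β false true = false then 1 else 0) +
    (if β true false = false then 1 else 0) + (if β true true = false then 1 else 0) : ℕ))

lemma hat_sum (β : Bool → Bool → Bool) :
    ind (hat β false false) + ind (hat β false true) + ind (hat β true false) + ind (hat β true true)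
    = ind (β false false) + ind (β false true) + ind (β true false) + ind (β true true) := by
  unfold hat ind
  cases β false false <;> cases β false true <;> cases β true false <;> cases β true true <;>
    norm_num

def fs : Fin 4 → Bool := ![false, false, true, true]
def ft : Fin 4 → Bool := ![false, true, false, true]

lemma local1 {α : ℝ} (hα : α ∈ Set.Icc (0:ℝ) (1/2)) (β : Bool → Bool → Bool) (s t : Bool) :
    Q α β s t ≤ Q α (hat β) false false ∧ Q α (hat β) true true ≤ Q α β s t := by
  obtain ⟨h0, h1⟩ := hα
  have h2 : 0 ≤ α * (1 - 2 * α) := mul_nonneg h0 (by linarith)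
  have h3 : 0 ≤ α * (1 - α) := mul_nonneg h0 (by linarith)
  have h4 : 0 ≤ (1 - 2 * α) * (1 - α) := mul_nonneg (by linarith) (by linarith)
  have h5 : 0 ≤ α * α := mul_nonneg h0 h0
  unfold Q hat ind K
  cases β false false <;> cases β false true <;> cases β true false <;> cases β true true <;>
    cases s <;> cases t <;> norm_num <;> (try constructor) <;> nlinarith

set_option maxHeartbeats 4000000 in
lemma local2 {α : ℝ} (hα : α ∈ Set.Icc (0:ℝ) (1/2)) (β : Bool → Bool → Bool) (s t s' t' : Bool)
    (hne : ¬ (s = s' ∧ t = t')) :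
    Q α β s t + Q α β s' t' ≤ Q α (hat β) false false + Q α (hat β) false true := by
  obtain ⟨h0, h1⟩ := hα
  have h2 : 0 ≤ α * (1 - 2 * α) := mul_nonneg h0 (by linarith)
  have h3 : 0 ≤ α * (1 - α) := mul_nonneg h0 (by linarith)
  have h4 : 0 ≤ (1 - 2 * α) * (1 - α) := mul_nonneg (by linarith) (by linarith)
  have h5 : 0 ≤ α * α := mul_nonneg h0 h0
  unfold Q hat ind K
  cases s <;> cases t <;> cases s' <;> cases t' <;> (try (exact absurd ⟨rfl, rfl⟩ hne)) <;>
  cases β false false <;> cases β false true <;> cases β true false <;> cases β true true <;>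
    norm_num <;> nlinarith

lemma Q_sum (α : ℝ) (β : Bool → Bool → Bool) :
    ∑ k, Q α β (fs k) (ft k) =
      ind (β false false) + ind (β false true) + ind (β true false) + ind (β true true) := by
  rw [Fin.sum_univ_four]
  simp [fs, ft, Q, K]
  ring

lemma hat_eq {n : ℕ} (b bhat : (Fin n → Bool) → Bool) (i j : Fin n) (hij : i < j)
    (h : Finset.univ.filter (fun x => bhat x = false) =
      compress {i, j} (Finset.univ.filter (fun x => b x = false))) (x : Fin n → Bool) :
    (fun s t => bhat (upd i j s t x)) = hat (fun s t => b (upd i j s t x)) := by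
  funext s t
  have hx := Finset.ext_iff.1 h (upd i j s t x)
  simp only [compress, mem_filter, mem_univ, true_and] at hx
  have h1 : secVal {i, j} (fun l => upd i j s t x l.val) =
      (if s then 2 else 0) + (if t then 1 else 0) := by
    unfold secVal
    rw [Finset.sum_coe_sort {i, j} (fun l => if upd i j s t x l then
      2 ^ (({i, j} : Finset (Fin n)).filter (fun m => l < m)).card else 0),
      Finset.sum_pair hij.ne]
    simp [upd, hij, hij.ne, Finset.filter_insert, Finset.filter_singleton, hij.not_gt]
  let e : Bool × Bool → ({l // l ∈ ({i, j} : Finset (Fin n))} → Bool) :=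
    fun q l => if l.val = i then q.1 else q.2
  have hi : i ∈ ({i, j} : Finset (Fin n)) := by simp
  have hj : j ∈ ({i, j} : Finset (Fin n)) := by simp
  have he : Function.Bijective e := by
    constructor
    · intro q q' hq
      have a1 := congrFun hq ⟨i, hi⟩
      have a2 := congrFun hq ⟨j, hj⟩
      simp [e, hij.ne'] at a1 a2
      exact Prod.ext a1 a2
    · intro z
      refine ⟨(z ⟨i, hi⟩, z ⟨j, hj⟩), ?_⟩
      funext l
      obtain ⟨l, hl⟩ := l
      have hl' := hl
      simp only [mem_insert, mem_singleton] at hl'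
      rcases hl' with rfl | rfl
      · simp [e]
      · simp [e, hij.ne']
  have hm : ∀ q, merge {i, j} (upd i j s t x) (e q) = upd i j q.1 q.2 x := by
    intro q
    funext l
    by_cases hli : l = i
    · subst hli; simp [merge, e, upd, hij.ne]
    · by_cases hlj : l = j
      · subst hlj; simp [merge, e, upd, hli]
      · simp [merge, upd, hli, hlj]
  have h2 : (Isection (Finset.univ.filter (fun x => b x = false)) {i, j} (upd i j s t x)).card =
      ((if b (upd i j false false x) = false then 1 else 0) +
       (if b (upd i j false true x) = false then 1 else 0) +
       (if b (upd i j true false x) = false then 1 else 0) +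
       (if b (upd i j true true x) = false then 1 else 0) : ℕ) := by
    unfold Isection
    rw [Finset.card_filter, ← he.sum_comp, Fintype.sum_prod_type]
    simp only [hm, Fintype.sum_bool, mem_filter, mem_univ, true_and]
    ring
  rw [h1, h2] at hx
  unfold hat
  cases hb : bhat (upd i j s t x)
  · have := hx.1 hb
    symm
    simpa using this
  · have := mt hx.2 (by simp [hb])
    symm
    simpa using this

theorem main (n : ℕ) (α : ℝ) (hα : α ∈ Set.Icc (0:ℝ) (1/2))
    (b bhat : (Fin n → Bool) → Bool) (i j : Fin n) (hij : i < j)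
    (h : Finset.univ.filter (fun x => bhat x = false) =
      compress {i, j} (Finset.univ.filter (fun x => b x = false))) :
    MI n α bhat ≥ MI n α b := by
  have hh := hat_eq b bhat i j hij h
  have hind : ∑ x, ind (bhat x) = ∑ x, ind (b x) := by
    rw [avg2 i j, avg2 i j (fun x => ind (b x))]
    congr 1
    apply Finset.sum_congr rfl
    intro x _
    have := hat_sum (fun s t => b (upd i j s t x))
    rw [← hh] at this
    exact this
  have hpf : ∀ c : (Fin n → Bool) → Bool, pB n c false = (1/2)^n * ∑ x, ind (c x) := by
    intro c
    unfold pB ind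
    rw [Finset.mul_sum]
    apply Finset.sum_congr rfl
    intro x _
    split_ifs <;> simp
  have hpt : ∀ c : (Fin n → Bool) → Bool, pB n c true = (1/2)^n * ∑ x, (1 - ind (c x)) := by
    intro c
    unfold pB ind
    rw [Finset.mul_sum]
    apply Finset.sum_congr rfl
    intro x _
    cases c x <;> simp
  have hHB : HB n bhat = HB n b := by
    unfold HB
    simp only [Fintype.sum_bool, hpf, hpt, Finset.sum_sub_distrib, hind]
  have hc : condHB n α bhat ≤ condHB n α b := by
    rw [condHB_eq, condHB_eq]
    apply mul_le_mul_of_nonneg_left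
    · rw [avg2 i j, avg2 i j (fun y => Real.binEntropy (P n α b y))]
      apply mul_le_mul_of_nonneg_left _ (by norm_num)
      apply Finset.sum_le_sum
      intro y _
      have hR : ∀ x, 0 ≤ 1 / 4 * R α i j x y := fun x =>
        mul_nonneg (by norm_num) (Finset.prod_nonneg fun _ _ => K_nonneg hα _ _)
      have hPhat : ∀ s t, P n α bhat (upd i j s t y) = ∑ x, (1 / 4 * R α i j x y) *
          Q α (hat (fun s t => b (upd i j s t x))) s t := by
        intro s t
        rw [P_upd α hij.ne]
        simp only [hh]
      have hk := kara (fun k => P n α bhat (upd i j (fs k) (ft k) y))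
        (fun k => P n α b (upd i j (fs k) (ft k) y)) (fun k => P_mem hα _ _)
        (fun k => P_mem hα _ _) ?_ ?_ ?_ ?_
      · rw [Fin.sum_univ_four, Fin.sum_univ_four] at hk
        exact hk
      · intro k
        rw [hPhat, P_upd α hij.ne]
        exact Finset.sum_le_sum fun x _ => mul_le_mul_of_nonneg_left (local1 hα _ _ _).1 (hR x)
      · intro k l hkl
        rw [hPhat, hPhat, P_upd α hij.ne, P_upd α hij.ne, ← Finset.sum_add_distrib,
          ← Finset.sum_add_distrib]
        refine Finset.sum_le_sum fun x _ => ?_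
        rw [← mul_add, ← mul_add]
        refine mul_le_mul_of_nonneg_left (local2 hα _ _ _ _ _ ?_) (hR x)
        revert k l
        decide
      · intro k
        rw [hPhat, P_upd α hij.ne]
        exact Finset.sum_le_sum fun x _ => mul_le_mul_of_nonneg_left (local1 hα _ _ _).2 (hR x)
      · simp only [hPhat, P_upd α hij.ne]
        rw [Finset.sum_comm, Finset.sum_comm (s := univ (α := Fin 4))]
        apply Finset.sum_congr rfl
        intro x _
        rw [← Finset.mul_sum, ← Finset.mul_sum, Q_sum, Q_sum, hat_sum]
    · exact div_nonneg (by positivity) (Real.log_nonneg (by norm_num))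
  unfold MI
  linarith

end TDC

/-- Two-dimensional compression does not decrease mutual information: for `|I| = 2`,
if `b̂⁻¹(0) = C_I(b⁻¹(0))` then `I(b̂(Xⁿ); Yⁿ) ≥ I(b(Xⁿ); Yⁿ)`. -/
theorem two_dim_compression (n : ℕ) (α : ℝ) (hα : α ∈ Set.Icc (0:ℝ) (1/2))
    (b bhat : (Fin n → Bool) → Bool) (I : Finset (Fin n)) (hI : I.card = 2)
    (h : Finset.univ.filter (fun x => bhat x = false) =
      compress I (Finset.univ.filter (fun x => b x = false))) :
    MI n α bhat ≥ MI n α b := by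
  obtain ⟨i, j, hij, rfl⟩ := Finset.card_eq_two.1 hI
  rcases lt_or_gt_of_ne hij with hlt | hlt
  · exact TDC.main n α hα b bhat i j hlt h
  · rw [Finset.pair_comm] at h
    exact TDC.main n α hα b bhat j i hlt h
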